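/- Suppose K is a symmetric convex body of dimension 2^(k+1)·n that is (2^((3/2)^k)·4)-semiround, with k ≥ 0. Then K has a 256-round n-dimensional subquotient, i.e., a slice of a projection K₀ of dimension n with an ellipsoid E₀ satisfying E₀ ⊆ K₀ ⊆ 256·E₀. -/

import Mathlib

open MeasureTheory Pointwise

/-- An ellipsoid: the image of the closed Euclidean unit ball under a linear bijection. -/
def IsEllipsoid {V : Type*} [AddCommGroup V] [Module ℝ V] (E : Set V) : Prop :=
  ∃ (m : ℕ) (L : EuclideanSpace ℝ (Fin m) →ₗ[ℝ] V), Function.Bijective L ∧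
    E = L '' Metric.closedBall 0 1

/-- A measure `μ` with an operation `m` satisfies the Prékopa–Leindler property if
`f x * g y ≤ h (m x y) ^ 2` for all `x`, `y` implies `(∫ f) (∫ g) ≤ (∫ h) ^ 2`. -/
def PrekopaLeindler {X : Type*} [MeasurableSpace X] (μ : Measure X) (m : X → X → X) : Prop :=
  ∀ f g h : X → ENNReal, Measurable f → Measurable g → Measurable h →
    (∀ x y, f x * g y ≤ h (m x y) ^ 2) →
    (∫⁻ x, f x ∂μ) * (∫⁻ x, g x ∂μ) ≤ (∫⁻ x, h x ∂μ) ^ 2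

theorem volume_add_volume_le_of_compact {A B C : Set ℝ} (hA : IsCompact A) (hB : IsCompact B)
    (hA0 : A.Nonempty) (hB0 : B.Nonempty) (h : ∀ a ∈ A, ∀ b ∈ B, a + b ∈ C) :
    volume A + volume B ≤ volume C := by
  obtain ⟨a, haA, ha⟩ := hA.exists_isGreatest hA0
  obtain ⟨b, hbB, hb⟩ := hB.exists_isLeast hB0
  have h1 : volume ((fun x => x + (-b)) ⁻¹' A) = volume A := measure_preimage_add_right _ _ _
  have h2 : volume ((fun x => x + (-a)) ⁻¹' B) = volume B := measure_preimage_add_right _ _ _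
  rw [← h1, ← h2, ← measure_union₀]
  · refine measure_mono ?_
    rintro x (hx | hx)
    · simpa using h _ hx _ hbB
    · simpa using h _ haA _ hx
  · exact ((continuous_add_const (-a)).measurable hB.measurableSet).nullMeasurableSet
  · refine measure_mono_null (t := {a + b}) ?_ (by simp)
    rintro x ⟨hx, hy⟩
    have := ha hx
    have := hb hy
    simp only [Set.mem_singleton_iff]
    linarith

theorem volume_add_volume_le {A B C : Set ℝ} (hA : MeasurableSet A) (hB : MeasurableSet B)
    (hA0 : A.Nonempty) (hB0 : B.Nonempty) (h : ∀ a ∈ A, ∀ b ∈ B, a + b ∈ C) :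
    volume A + volume B ≤ volume C := by
  obtain ⟨a, ha⟩ := hA0
  obtain ⟨b, hb⟩ := hB0
  rw [hA.measure_eq_iSup_isCompact, hB.measure_eq_iSup_isCompact]
  simp only [iSup_and']
  refine ENNReal.biSup_add_biSup_le' ⟨∅, by simp⟩ ⟨∅, by simp⟩ ?_
  rintro K ⟨hKA, hK⟩ L ⟨hLB, hL⟩
  calc volume K + volume L ≤ volume (insert a K) + volume (insert b L) := by
        gcongr <;> exact Set.subset_insert _ _
    _ ≤ volume C := by
        refine volume_add_volume_le_of_compact (hK.insert a) (hL.insert b) ⟨a, by simp⟩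
          ⟨b, by simp⟩ ?_
        intro x hx y hy
        exact h _ (Set.insert_subset ha hKA hx) _ (Set.insert_subset hb hLB hy)

theorem volume_add_volume_le_two_mul {A B C : Set ℝ} (hA : MeasurableSet A) (hB : MeasurableSet B)
    (hA0 : A.Nonempty) (hB0 : B.Nonempty) (h : ∀ a ∈ A, ∀ b ∈ B, (a + b) / 2 ∈ C) :
    volume A + volume B ≤ 2 * volume C := by
  have h1 : volume ((fun x => (2 : ℝ)⁻¹ * x) ⁻¹' C) = 2 * volume C := by
    rw [Real.volume_preimage_mul_left (by norm_num)]
    simp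
  rw [← h1]
  refine volume_add_volume_le hA hB hA0 hB0 fun a ha b hb => ?_
  have := h a ha b hb
  rw [div_eq_inv_mul] at this
  exact this

theorem ENNReal.mul_le_sq_of_add_le_two_mul {a b c : ENNReal} (h : a + b ≤ 2 * c) :
    a * b ≤ c ^ 2 := by
  rcases eq_or_ne c ⊤ with rfl | hc
  · simp
  have hab : a + b ≠ ⊤ := ne_top_of_le_ne_top (ENNReal.mul_ne_top (by simp) hc) h
  rw [ENNReal.add_ne_top] at hab
  lift a to NNReal using hab.1
  lift b to NNReal using hab.2
  lift c to NNReal using hc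
  norm_cast at h ⊢
  rw [← NNReal.coe_le_coe] at h ⊢
  push_cast at h ⊢
  nlinarith [sq_nonneg ((a : ℝ) - b), a.2, b.2, c.2, mul_self_le_mul_self (by positivity) h]

theorem lintegral_eq_lintegral_volume_lt {f : ℝ → ENNReal} (hf : Measurable f)
    (hf1 : ∀ x, f x ≤ 1) :
    ∫⁻ x, f x = ∫⁻ t in Set.Ioi (0 : ℝ), volume {x | ENNReal.ofReal t < f x} := by
  have h := lintegral_eq_lintegral_meas_lt (f := fun x => (f x).toReal) (volume : Measure ℝ)
    (Filter.Eventually.of_forall fun _ => ENNReal.toReal_nonneg) hf.ennreal_toReal.aemeasurable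
  have h1 : ∀ x, f x ≠ ⊤ := fun x => ne_top_of_le_ne_top ENNReal.one_ne_top (hf1 x)
  simp only [ENNReal.ofReal_toReal (h1 _)] at h
  rw [h]
  refine setLIntegral_congr_fun measurableSet_Ioi fun t ht => ?_
  congr 1
  ext x
  exact (ENNReal.ofReal_lt_iff_lt_toReal (le_of_lt ht) (h1 x)).symm

theorem lintegral_add_le_two_mul_of_iSup_eq_one {f g h : ℝ → ENNReal} (hf : Measurable f)
    (hg : Measurable g) (hh : Measurable h) (hf1 : ⨆ x, f x = 1) (hg1 : ⨆ x, g x = 1)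
    (H : ∀ x y, f x * g y ≤ h ((x + y) / 2) ^ 2) :
    (∫⁻ x, f x) + (∫⁻ x, g x) ≤ 2 * ∫⁻ x, h x := by
  have hfle : ∀ x, f x ≤ 1 := fun x => hf1 ▸ le_iSup f x
  have hgle : ∀ x, g x ≤ 1 := fun x => hg1 ▸ le_iSup g x
  calc (∫⁻ x, f x) + (∫⁻ x, g x) ≤ 2 * ∫⁻ x, min (h x) 1 := by
        rw [lintegral_eq_lintegral_volume_lt hf hfle, lintegral_eq_lintegral_volume_lt hg hgle,
          lintegral_eq_lintegral_volume_lt (hh.min measurable_const) fun x => min_le_right _ _,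
          ← lintegral_const_mul' _ _ (by simp)]
        refine (le_lintegral_add _ _).trans (lintegral_mono fun t => ?_)
        rcases le_or_gt 1 (ENNReal.ofReal t) with ht | ht
        · have h1 : {x | ENNReal.ofReal t < f x} = ∅ := by
            ext x; simpa using (hfle x).trans ht
          have h2 : {x | ENNReal.ofReal t < g x} = ∅ := by
            ext x; simpa using (hgle x).trans ht
          simp [h1, h2]
        · refine volume_add_volume_le_two_mul (measurableSet_lt measurable_const hf)
            (measurableSet_lt measurable_const hg) (lt_iSup_iff.1 (ht.trans_eq hf1.symm))
            (lt_iSup_iff.1 (ht.trans_eq hg1.symm)) fun a ha b hb => ?_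
          refine lt_min ?_ ht
          have h3 : ENNReal.ofReal t ^ 2 < h ((a + b) / 2) ^ 2 := by
            refine lt_of_lt_of_le ?_ (H a b)
            rw [sq]
            exact ENNReal.mul_lt_mul ha hb
          exact lt_of_pow_lt_pow_left' 2 h3
    _ ≤ 2 * ∫⁻ x, h x := by gcongr; exact min_le_left _ _

theorem lintegral_mul_le_sq_of_iSup_ne_top {f g h : ℝ → ENNReal} (hf : Measurable f)
    (hg : Measurable g) (hh : Measurable h) (hf1 : ⨆ x, f x ≠ ⊤) (hg1 : ⨆ x, g x ≠ ⊤)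
    (H : ∀ x y, f x * g y ≤ h ((x + y) / 2) ^ 2) :
    (∫⁻ x, f x) * (∫⁻ x, g x) ≤ (∫⁻ x, h x) ^ 2 := by
  rcases eq_or_ne (⨆ x, f x) 0 with ha | ha
  · simp [ENNReal.iSup_eq_zero.1 ha]
  rcases eq_or_ne (⨆ x, g x) 0 with hb | hb
  · simp [ENNReal.iSup_eq_zero.1 hb]
  set a := ⨆ x, f x with hadef
  set b := ⨆ x, g x with hbdef
  obtain ⟨c, hc⟩ : ∃ c : ENNReal, c ^ 2 = a * b :=
    ⟨(a * b) ^ (1 / 2 : ℝ), by rw [← ENNReal.rpow_natCast, ← ENNReal.rpow_mul]; norm_num⟩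
  have hc0 : c ≠ 0 := by rintro rfl; simp [ha, hb] at hc
  have hct : c ≠ ⊤ := by
    rintro rfl
    exact ENNReal.mul_ne_top hf1 hg1 (by simpa using hc.symm)
  have key := lintegral_add_le_two_mul_of_iSup_eq_one (f := fun x => a⁻¹ * f x)
    (g := fun x => b⁻¹ * g x) (h := fun x => c⁻¹ * h x) (hf.const_mul _) (hg.const_mul _)
    (hh.const_mul _) (by rw [← ENNReal.mul_iSup, ENNReal.inv_mul_cancel ha hf1])
    (by rw [← ENNReal.mul_iSup, ENNReal.inv_mul_cancel hb hg1]) (fun x y => by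
      rw [mul_pow, ← ENNReal.inv_pow, hc, ENNReal.mul_inv (Or.inl ha) (Or.inl hf1),
        mul_mul_mul_comm]
      gcongr
      exact H x y)
  rw [lintegral_const_mul _ hf, lintegral_const_mul _ hg, lintegral_const_mul _ hh] at key
  have := ENNReal.mul_le_sq_of_add_le_two_mul key
  rw [mul_pow, ← ENNReal.inv_pow, hc, mul_mul_mul_comm,
    ← ENNReal.mul_inv (Or.inl ha) (Or.inl hf1)] at this
  rwa [ENNReal.mul_le_mul_iff_right (by simp [ENNReal.mul_ne_top hf1 hg1]) (by simp [ha, hb])] at this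

theorem prekopaLeindler_real : PrekopaLeindler (volume : Measure ℝ) fun x y => (x + y) / 2 := by
  intro f g h hf hg hh H
  have hmono : ∀ {u : ℝ → ENNReal}, Measurable u →
      ∫⁻ x, u x = ⨆ n : ℕ, ∫⁻ x, min (u x) n := by
    intro u hu
    rw [← lintegral_iSup (fun n => hu.min measurable_const)
      (fun m n hmn x => min_le_min_left _ (by exact_mod_cast hmn))]
    congr 1
    ext x
    refine le_antisymm ?_ (iSup_le fun n => min_le_left _ _)
    rcases eq_or_ne (u x) ⊤ with hx | hx
    · simp [hx, ENNReal.iSup_natCast]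
    · obtain ⟨n, hn⟩ := ENNReal.exists_nat_gt hx
      exact le_iSup_of_le n (by simp [hn.le])
  have hbdd : ∀ (u : ℝ → ENNReal) (n : ℕ), ⨆ x, min (u x) (n : ENNReal) ≠ ⊤ := fun u n =>
    ne_top_of_le_ne_top (ENNReal.natCast_ne_top n) (iSup_le fun _ => min_le_right _ _)
  rw [hmono hf, hmono hg, ENNReal.iSup_mul]
  refine iSup_le fun m => ?_
  rw [ENNReal.mul_iSup]
  refine iSup_le fun n => ?_
  refine lintegral_mul_le_sq_of_iSup_ne_top (hf.min measurable_const) (hg.min measurable_const) hh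
    (hbdd f m) (hbdd g n) fun x y => (H x y).trans' ?_
  gcongr <;> exact min_le_left _ _

theorem PrekopaLeindler.prod {X Y : Type*} [MeasurableSpace X] [MeasurableSpace Y]
    {μ : Measure X} {ν : Measure Y} [SFinite μ] [SFinite ν] {m : X → X → X} {m' : Y → Y → Y}
    (h₁ : PrekopaLeindler μ m) (h₂ : PrekopaLeindler ν m') :
    PrekopaLeindler (μ.prod ν) fun p q => (m p.1 q.1, m' p.2 q.2) := by
  intro f g h hf hg hh H
  rw [lintegral_prod _ hf.aemeasurable, lintegral_prod _ hg.aemeasurable,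
    lintegral_prod _ hh.aemeasurable]
  refine h₁ _ _ _ hf.lintegral_prod_right' hg.lintegral_prod_right' hh.lintegral_prod_right'
    fun x y => ?_
  exact h₂ _ _ _ (hf.comp measurable_prodMk_left) (hg.comp measurable_prodMk_left)
    (hh.comp measurable_prodMk_left) fun u v => H (x, u) (y, v)

theorem PrekopaLeindler.of_measurePreserving {X Y : Type*} [MeasurableSpace X] [MeasurableSpace Y]
    {μ : Measure X} {ν : Measure Y} {m : X → X → X} {m' : Y → Y → Y} (e : X ≃ᵐ Y)
    (he : MeasurePreserving e μ ν) (h : PrekopaLeindler ν m')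
    (hm : ∀ x y, e (m x y) = m' (e x) (e y)) : PrekopaLeindler μ m := by
  intro f g k hf hg hk H
  have hs : ∀ u : X → ENNReal, ∫⁻ x, u x ∂μ = ∫⁻ y, u (e.symm y) ∂ν := fun u => by
    rw [← he.map_eq, lintegral_map_equiv]
    simp
  rw [hs f, hs g, hs k]
  refine h _ _ _ (hf.comp e.symm.measurable) (hg.comp e.symm.measurable)
    (hk.comp e.symm.measurable) fun x y => ?_
  have h1 : e.symm (m' x y) = m (e.symm x) (e.symm y) := by
    rw [e.symm_apply_eq, hm]; simp
  rw [h1]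
  exact H _ _

theorem PrekopaLeindler.pi {X : Type*} [MeasurableSpace X] {μ : Measure X} [SigmaFinite μ]
    {m : X → X → X} (h : PrekopaLeindler μ m) (n : ℕ) :
    PrekopaLeindler (Measure.pi fun _ : Fin n => μ) fun x y i => m (x i) (y i) := by
  induction n with
  | zero =>
    intro f g k hf hg hk H
    rw [Measure.pi_of_empty, lintegral_dirac, lintegral_dirac, lintegral_dirac]
    refine (H _ _).trans_eq ?_
    congr 2
    exact Subsingleton.elim _ _
  | succ n ih =>
    exact (h.prod ih).of_measurePreserving (MeasurableEquiv.piFinSuccAbove (fun _ => X) 0)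
      (measurePreserving_piFinSuccAbove (fun _ => μ) 0) fun x y => rfl

theorem lintegral_map_abs (f : ℝ → ENNReal) (hf : Measurable f) :
    ∫⁻ x, f x ∂(Measure.map abs (volume : Measure ℝ)) = 2 * ∫⁻ x in Set.Ioi 0, f x := by
  rw [lintegral_map hf (by fun_prop), ← lintegral_add_compl _ (measurableSet_Ioi (a := (0 : ℝ))),
    two_mul]
  congr 1
  · exact setLIntegral_congr_fun measurableSet_Ioi fun x hx => by rw [abs_of_pos hx]
  · rw [Set.compl_Ioi, ← setLIntegral_congr (Iio_ae_eq_Iic (a := (0 : ℝ))),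
      ← (Measure.measurePreserving_neg (volume : Measure ℝ)).setLIntegral_comp_preimage
        measurableSet_Ioi hf]
    simp only [Set.neg_preimage, Set.neg_Ioi, neg_zero]
    exact setLIntegral_congr_fun measurableSet_Iio fun x hx => by rw [abs_of_neg hx]

theorem lintegral_Ioi_eq_lintegral_exp (f : ℝ → ENNReal) :
    ∫⁻ x in Set.Ioi 0, f x = ∫⁻ s, ENNReal.ofReal (Real.exp s) * f (Real.exp s) := by
  have := lintegral_image_eq_lintegral_abs_deriv_mul (s := Set.univ) (f := Real.exp)
    (f' := Real.exp) MeasurableSet.univ (fun x _ => (Real.hasDerivAt_exp x).hasDerivWithinAt)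
    Real.exp_injective.injOn f
  simpa [Real.range_exp, abs_of_pos (Real.exp_pos _)] using this

theorem prekopaLeindler_map_abs :
    PrekopaLeindler (Measure.map abs (volume : Measure ℝ)) fun x y => Real.sqrt |x * y| := by
  intro f g h hf hg hh H
  rw [lintegral_map_abs f hf, lintegral_map_abs g hg, lintegral_map_abs h hh, mul_mul_mul_comm,
    mul_pow, ← sq]
  gcongr
  simp only [lintegral_Ioi_eq_lintegral_exp]
  refine prekopaLeindler_real _ _ _ (by fun_prop) (by fun_prop) (by fun_prop) fun x y => ?_
  have h1 := H (Real.exp x) (Real.exp y)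
  have h2 : Real.sqrt |Real.exp x * Real.exp y| = Real.exp ((x + y) / 2) := by
    rw [← Real.exp_add, abs_of_pos (Real.exp_pos _), Real.sqrt_eq_iff_mul_self_eq
      (Real.exp_pos _).le (Real.exp_pos _).le, ← Real.exp_add]
    ring_nf
  simp only [h2] at h1
  have h3 : ENNReal.ofReal (Real.exp x) * ENNReal.ofReal (Real.exp y) =
      ENNReal.ofReal (Real.exp ((x + y) / 2)) ^ 2 := by
    rw [← ENNReal.ofReal_mul (Real.exp_pos _).le, ← ENNReal.ofReal_pow (Real.exp_pos _).le,
      ← Real.exp_add, ← Real.exp_nat_mul]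
    ring_nf
  rw [mul_mul_mul_comm, h3, mul_pow]
  gcongr

theorem PrekopaLeindler.pi_fintype {ι X : Type*} [Fintype ι] [MeasurableSpace X] {μ : Measure X}
    [SigmaFinite μ] {m : X → X → X} (h : PrekopaLeindler μ m) :
    PrekopaLeindler (Measure.pi fun _ : ι => μ) fun x y i => m (x i) (y i) :=
  (h.pi (Fintype.card ι)).of_measurePreserving
    (MeasurableEquiv.piCongrLeft (fun _ => X) (Fintype.equivFin ι))
    (measurePreserving_piCongrLeft (fun _ => μ) (Fintype.equivFin ι)) fun x y => by
      ext i
      obtain ⟨j, rfl⟩ := (Fintype.equivFin ι).surjective i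
      simp [MeasurableEquiv.coe_piCongrLeft]

theorem prekopaLeindler_pi (ι : Type*) [Fintype ι] :
    PrekopaLeindler (volume : Measure (ι → ℝ)) fun x y i => (x i + y i) / 2 :=
  prekopaLeindler_real.pi_fintype

theorem PrekopaLeindler.measure_mul_le {X : Type*} [MeasurableSpace X] {μ : Measure X}
    {m : X → X → X} (h : PrekopaLeindler μ m) {A B C : Set X} (hA : MeasurableSet A)
    (hB : MeasurableSet B) (hC : MeasurableSet C) (H : ∀ a ∈ A, ∀ b ∈ B, m a b ∈ C) :
    μ A * μ B ≤ μ C ^ 2 := by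
  rw [← lintegral_indicator_one hA, ← lintegral_indicator_one hB, ← lintegral_indicator_one hC]
  refine h _ _ _ (measurable_one.indicator hA) (measurable_one.indicator hB)
    (measurable_one.indicator hC) fun x y => ?_
  by_cases hx : x ∈ A
  · by_cases hy : y ∈ B
    · simp [hx, hy, H x hx y hy]
    · simp [hy]
  · simp [hx]

theorem measure_le_of_prod_symm {X ι : Type*} [MeasurableSpace X] [Fintype ι] {μ : Measure X}
    [SFinite μ] {S Z : Set (X × (ι → ℝ))} (hS : MeasurableSet S) (hZ : MeasurableSet Z)
    (H : ∀ x y y', (x, y) ∈ S → (x, y') ∈ S → (x, fun i => (y i - y' i) / 2) ∈ Z) :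
    (μ.prod volume) S ≤ (μ.prod volume) Z := by
  rw [Measure.prod_apply hS, Measure.prod_apply hZ]
  refine lintegral_mono fun x => ?_
  have h1 : MeasurableSet (Prod.mk x ⁻¹' S) := measurable_prodMk_left hS
  have h2 : MeasurableSet (Prod.mk x ⁻¹' Z) := measurable_prodMk_left hZ
  have h3 := (prekopaLeindler_pi ι).measure_mul_le h1 h1.neg h2 (fun a ha b hb => by
    have := H x a (-b) ha hb
    simpa using this)
  rw [Measure.measure_neg, ← sq] at h3
  exact (ENNReal.pow_le_pow_left_iff (by norm_num)).1 h3

section Symmetrize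

variable {ι : Type*}

/-- Symmetrization with respect to the coordinates in `I`: every fiber `F` of `A` in the direction
of these coordinates is replaced by `(F - F) / 2`. -/
def symmetrize (I : Set ι) (A : Set (ι → ℝ)) : Set (ι → ℝ) :=
  {z | ∃ a ∈ A, ∃ c ∈ A, (∀ j ∉ I, a j = c j ∧ z j = a j) ∧ ∀ j ∈ I, z j = (a j - c j) / 2}

theorem IsCompact.symmetrize {I : Set ι} {A : Set (ι → ℝ)} (hA : IsCompact A) :
    IsCompact (symmetrize I A) := by
  classical
  have h1 : IsCompact {p ∈ A ×ˢ A | ∀ j ∉ I, p.1 j = p.2 j} := by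
    refine (hA.prod hA).inter_right (t := {p | ∀ j ∉ I, p.1 j = p.2 j}) ?_
    simp only [Set.ofPred_forall]
    exact isClosed_iInter fun j => isClosed_iInter fun _ =>
      isClosed_eq (by fun_prop) (by fun_prop)
  have h2 : Continuous fun (p : (ι → ℝ) × (ι → ℝ)) (j : ι) =>
      if j ∈ I then (p.1 j - p.2 j) / 2 else p.1 j := by
    refine continuous_pi fun j => ?_
    split_ifs <;> fun_prop
  convert h1.image h2 using 1
  ext z
  constructor
  · rintro ⟨a, ha, c, hc, h, h'⟩
    refine ⟨(a, c), ⟨⟨ha, hc⟩, fun j hj => (h j hj).1⟩, ?_⟩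
    ext j
    by_cases hj : j ∈ I
    · simp [hj, h' j hj]
    · simp [hj, (h j hj).2]
  · rintro ⟨⟨a, c⟩, ⟨⟨ha, hc⟩, h⟩, rfl⟩
    exact ⟨a, ha, c, hc, fun j hj => ⟨h j hj, by simp [hj]⟩, fun j hj => by simp [hj]⟩

theorem volume_le_volume_symmetrize [Fintype ι] (I : Set ι) {A : Set (ι → ℝ)} (hA : IsCompact A) :
    volume A ≤ volume (symmetrize I A) := by
  classical
  have he := volume_preserving_piEquivPiSubtypeProd (fun _ : ι => ℝ) (fun j => j ∉ I)
  set e := MeasurableEquiv.piEquivPiSubtypeProd (fun _ : ι => ℝ) (fun j => j ∉ I)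
  have hs : ∀ S : Set (ι → ℝ), volume S = volume (e.symm ⁻¹' S) := fun S =>
    (he.symm.measure_preimage_equiv S).symm
  rw [hs A, hs (symmetrize I A)]
  refine measure_le_of_prod_symm (e.symm.measurable hA.measurableSet)
    (e.symm.measurable hA.symmetrize.measurableSet) fun x y y' hy hy' => ?_
  refine ⟨_, hy, _, hy', fun j hj => ?_, fun j hj => ?_⟩
  · simp [e, MeasurableEquiv.piEquivPiSubtypeProd, hj]
  · simp [e, MeasurableEquiv.piEquivPiSubtypeProd, hj]

theorem neg_mem_symmetrize {I : Set ι} {A : Set (ι → ℝ)} (hA : ∀ x ∈ A, -x ∈ A) :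
    ∀ x ∈ symmetrize I A, -x ∈ symmetrize I A := by
  rintro z ⟨a, ha, c, hc, h, h'⟩
  refine ⟨-a, hA a ha, -c, hA c hc, fun j hj => ?_, fun j hj => ?_⟩
  · simp [(h j hj).1, (h j hj).2]
  · simp only [Pi.neg_apply, h' j hj]; ring

theorem abs_sum_mul_symmetrize_le [Fintype ι] {A B : Set (ι → ℝ)} (i : ι)
    (H : ∀ x ∈ A, ∀ y ∈ B, |∑ j, x j * y j| ≤ 1) :
    ∀ x ∈ symmetrize {i} A, ∀ y ∈ symmetrize {i}ᶜ B, |∑ j, x j * y j| ≤ 1 := by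
  rintro x ⟨a, ha, c, hc, h, h'⟩ y ⟨b, hb, d, hd, k, k'⟩
  have h1 : ∑ j, x j * y j = ((∑ j, a j * b j) - ∑ j, c j * d j) / 2 := by
    rw [← Finset.sum_sub_distrib, Finset.sum_div]
    refine Finset.sum_congr rfl fun j _ => ?_
    rcases eq_or_ne j i with rfl | hji
    · rw [h' j rfl, (k j (by simp)).2, ← (k j (by simp)).1]; ring
    · rw [(h j hji).2, k' j hji, ← (h j hji).1]; ring
  have h2 := abs_le.1 (H a ha b hb)
  have h3 := abs_le.1 (H c hc d hd)
  rw [h1, abs_le]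
  constructor <;> linarith

variable [DecidableEq ι]

/-- Invariance under the reflection in the `i`-th coordinate hyperplane. -/
def FlipInvariant (i : ι) (A : Set (ι → ℝ)) : Prop :=
  ∀ x ∈ A, Function.update x i (-x i) ∈ A

theorem FlipInvariant.symmetrize {i : ι} {I : Set ι} {A : Set (ι → ℝ)} (hA : FlipInvariant i A) :
    FlipInvariant i (symmetrize I A) := by
  rintro z ⟨a, ha, c, hc, h, h'⟩
  refine ⟨_, hA a ha, _, hA c hc, fun j hj => ?_, fun j hj => ?_⟩
  · rcases eq_or_ne j i with rfl | hji
    · simp [(h j hj).1, (h j hj).2]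
    · simp [hji, (h j hj).1, (h j hj).2]
  · rcases eq_or_ne j i with rfl | hji
    · simp only [Function.update_self, h' j hj]; ring
    · simp [hji, h' j hj]

theorem flipInvariant_symmetrize_singleton (i : ι) (A : Set (ι → ℝ)) :
    FlipInvariant i (symmetrize {i} A) := by
  rintro z ⟨a, ha, c, hc, h, h'⟩
  refine ⟨c, hc, a, ha, fun j hj => ?_, fun j hj => ?_⟩
  · have hji : j ≠ i := hj
    simp [hji, (h j hj).1, (h j hj).2]
  · obtain rfl : j = i := hj
    simp only [Function.update_self, h' j rfl]; ring

theorem flipInvariant_symmetrize_compl_singleton (i : ι) {A : Set (ι → ℝ)}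
    (hA : ∀ x ∈ A, -x ∈ A) : FlipInvariant i (symmetrize {i}ᶜ A) := by
  rintro z ⟨a, ha, c, hc, h, h'⟩
  refine ⟨-c, hA c hc, -a, hA a ha, fun j hj => ?_, fun j hj => ?_⟩
  · obtain rfl : j = i := by simpa using hj
    simp [(h j hj).1, (h j hj).2]
  · have hji : j ≠ i := hj
    simp only [Function.update_of_ne hji, h' j hj, Pi.neg_apply]; ring

theorem exists_flipInvariant_pair [Fintype ι] {A B : Set (ι → ℝ)} (hA : IsCompact A)
    (hB : IsCompact B) (hBs : ∀ x ∈ B, -x ∈ B) (H : ∀ x ∈ A, ∀ y ∈ B, |∑ j, x j * y j| ≤ 1)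
    (s : Finset ι) : ∃ A' B' : Set (ι → ℝ), IsCompact A' ∧ IsCompact B' ∧ (∀ x ∈ B', -x ∈ B') ∧
      (∀ x ∈ A', ∀ y ∈ B', |∑ j, x j * y j| ≤ 1) ∧ volume A ≤ volume A' ∧ volume B ≤ volume B' ∧
      ∀ i ∈ s, FlipInvariant i A' ∧ FlipInvariant i B' := by
  induction s using Finset.induction_on with
  | empty => exact ⟨A, B, hA, hB, hBs, H, le_rfl, le_rfl, by simp⟩
  | insert i s _ ih =>
    obtain ⟨A', B', hA', hB', hs', H', vA, vB, hf⟩ := ih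
    refine ⟨symmetrize {i} A', symmetrize {i}ᶜ B', hA'.symmetrize, hB'.symmetrize,
      neg_mem_symmetrize hs', abs_sum_mul_symmetrize_le i H',
      vA.trans (volume_le_volume_symmetrize _ hA'), vB.trans (volume_le_volume_symmetrize _ hB'), ?_⟩
    intro j hj
    rcases Finset.mem_insert.1 hj with rfl | hj
    · exact ⟨flipInvariant_symmetrize_singleton _ _,
        flipInvariant_symmetrize_compl_singleton _ hs'⟩
    · exact ⟨(hf j hj).1.symmetrize, (hf j hj).2.symmetrize⟩

theorem mem_of_abs_eq_of_flipInvariant [Fintype ι] {A : Set (ι → ℝ)}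
    (hA : ∀ i, FlipInvariant i A) {x y : ι → ℝ} (hx : x ∈ A) (h : ∀ i, |y i| = |x i|) : y ∈ A := by
  have key : ∀ s : Finset ι, (fun j => if j ∈ s then y j else x j) ∈ A := by
    intro s
    induction s using Finset.induction_on with
    | empty => simpa using hx
    | insert i s hi ih =>
      rcases abs_eq_abs.1 (h i) with hyx | hyx
      · convert ih using 2 with j
        rcases eq_or_ne j i with rfl | hji
        · simp [hi, hyx]
        · simp [hji]
      · convert hA i _ ih using 1
        ext j
        rcases eq_or_ne j i with rfl | hji
        · simp [hi, hyx]
        · simp [hji]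
  simpa using key Finset.univ

instance : SigmaFinite (Measure.map abs (volume : Measure ℝ)) := by
  refine ⟨⟨⟨fun n => Set.Iio (n : ℝ), fun _ => trivial, fun n => ?_, ?_⟩⟩⟩
  · rw [Measure.map_apply (by fun_prop) measurableSet_Iio]
    refine lt_of_le_of_lt (measure_mono (t := Set.Icc (-n : ℝ) n) ?_) (by simp)
    intro x hx
    exact abs_le.1 (le_of_lt hx)
  · exact Set.eq_univ_of_forall fun x => Set.mem_iUnion.2 (exists_nat_gt x)

theorem volume_mul_volume_le_of_flipInvariant [Fintype ι] {A B : Set (ι → ℝ)}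
    (hA : MeasurableSet A) (hB : MeasurableSet B) (hAf : ∀ i, FlipInvariant i A)
    (hBf : ∀ i, FlipInvariant i B) (H : ∀ x ∈ A, ∀ y ∈ B, |∑ j, x j * y j| ≤ 1) :
    volume A * volume B ≤ volume {x : ι → ℝ | ∑ j, x j ^ 2 ≤ 1} ^ 2 := by
  have hC : MeasurableSet {x : ι → ℝ | ∑ j, x j ^ 2 ≤ 1} :=
    measurableSet_le (by fun_prop) measurable_const
  have hmap : (volume : Measure (ι → ℝ)).map (fun x i => |x i|) =
      Measure.pi fun _ : ι => Measure.map abs (volume : Measure ℝ) :=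
    Measure.pi_map_pi (fun i => by fun_prop)
  have hvol : ∀ {S : Set (ι → ℝ)}, MeasurableSet S → (∀ x, (fun i => |x i|) ∈ S ↔ x ∈ S) →
      volume S = (Measure.pi fun _ : ι => Measure.map abs (volume : Measure ℝ)) S := by
    intro S hS h
    rw [← hmap, Measure.map_apply (by fun_prop) hS]
    congr 1
    ext x
    exact (h x).symm
  have habs : ∀ {S : Set (ι → ℝ)}, (∀ i, FlipInvariant i S) → ∀ x, (fun i => |x i|) ∈ S ↔ x ∈ S :=
    fun hS x => ⟨fun h => mem_of_abs_eq_of_flipInvariant hS h (by simp),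
      fun h => mem_of_abs_eq_of_flipInvariant hS h (by simp)⟩
  rw [hvol hA (habs hAf), hvol hB (habs hBf), hvol hC (by simp)]
  refine prekopaLeindler_map_abs.pi_fintype.measure_mul_le hA hB hC fun a ha b hb => ?_
  have h1 := H _ ((habs hAf a).2 ha) _ ((habs hBf b).2 hb)
  simp only [Set.mem_ofPred_eq]
  refine (le_abs_self _).trans (h1.trans' (le_of_eq ?_))
  congr 1
  exact Finset.sum_congr rfl fun j _ => by rw [Real.sq_sqrt (abs_nonneg _), abs_mul]

/-- The Blaschke–Santaló inequality for symmetric bodies. -/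
theorem volume_mul_volume_le_of_abs_sum_mul_le_one [Fintype ι] {A B : Set (ι → ℝ)}
    (hA : IsCompact A) (hB : IsCompact B) (hBs : ∀ x ∈ B, -x ∈ B)
    (H : ∀ x ∈ A, ∀ y ∈ B, |∑ j, x j * y j| ≤ 1) :
    volume A * volume B ≤ volume {x : ι → ℝ | ∑ j, x j ^ 2 ≤ 1} ^ 2 := by
  obtain ⟨A', B', hA', hB', -, H', vA, vB, hf⟩ :=
    exists_flipInvariant_pair hA hB hBs H Finset.univ
  exact (mul_le_mul' vA vB).trans (volume_mul_volume_le_of_flipInvariant hA'.measurableSet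
    hB'.measurableSet (fun i => (hf i (Finset.mem_univ i)).1)
    (fun i => (hf i (Finset.mem_univ i)).2) H')

end Symmetrize

/-- The Blaschke–Santaló inequality for symmetric bodies in a Euclidean space. -/
theorem volume_mul_volume_le_of_abs_inner_le_one {ι : Type*} [Fintype ι]
    {A B : Set (EuclideanSpace ℝ ι)} (hA : IsCompact A) (hB : IsCompact B)
    (hBs : ∀ x ∈ B, -x ∈ B) (H : ∀ x ∈ A, ∀ y ∈ B, |inner ℝ x y| ≤ 1) :
    volume A * volume B ≤ volume (Metric.closedBall (0 : EuclideanSpace ℝ ι) 1) ^ 2 := by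
  classical
  have hs : ∀ S : Set (EuclideanSpace ℝ ι), IsCompact S →
      volume S = volume (WithLp.toLp 2 ⁻¹' S) := fun S hS =>
    ((PiLp.volume_preserving_toLp ι).measure_preimage hS.measurableSet.nullMeasurableSet).symm
  have hc : ∀ S : Set (EuclideanSpace ℝ ι), IsCompact S →
      IsCompact (WithLp.toLp 2 ⁻¹' S : Set (ι → ℝ)) := fun S hS =>
    (PiLp.homeomorph 2 fun _ : ι => ℝ).symm.isCompact_preimage.2 hS
  rw [hs A hA, hs B hB, hs _ (isCompact_closedBall _ _)]
  convert volume_mul_volume_le_of_abs_sum_mul_le_one (hc A hA) (hc B hB)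
    (fun x hx => hBs _ hx) (fun x hx y hy => ?_) using 3
  · ext x
    simp [EuclideanSpace.norm_eq, Real.sqrt_le_one]
  · have := H _ hx _ hy
    simpa [PiLp.inner_apply, mul_comm] using this

/-- `K` has a `256`-round `n`-dimensional subquotient, presented by a linear relation between the
ambient space of `K` and the Euclidean space of dimension `n`. -/
def HasRoundSubquotient {V : Type*} [AddCommGroup V] [Module ℝ V] (n : ℕ) (K : Set V) : Prop :=
  ∃ Γ : Submodule ℝ (V × EuclideanSpace ℝ (Fin n)),
    (∀ z, ‖z‖ ≤ 1 → ∃ x ∈ K, (x, z) ∈ Γ) ∧ ∀ x ∈ K, ∀ z, (x, z) ∈ Γ → ‖z‖ ≤ 256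

theorem HasRoundSubquotient.of_preimage {V V' : Type*} [AddCommGroup V] [Module ℝ V]
    [AddCommGroup V'] [Module ℝ V'] {n : ℕ} {K : Set V} (i : V' →ₗ[ℝ] V)
    (h : HasRoundSubquotient n (i ⁻¹' K)) : HasRoundSubquotient n K := by
  obtain ⟨Γ, h1, h2⟩ := h
  refine ⟨Γ.map (i.prodMap LinearMap.id), fun z hz => ?_, ?_⟩
  · obtain ⟨x, hx, hxz⟩ := h1 z hz
    exact ⟨i x, hx, (x, z), hxz, rfl⟩
  · rintro x hx z ⟨⟨y, w⟩, hyw, h⟩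
    obtain ⟨rfl, rfl⟩ := Prod.mk.injEq .. ▸ h
    exact h2 y hx _ hyw

theorem HasRoundSubquotient.exists_quotient {V : Type*} [AddCommGroup V] [Module ℝ V] {n : ℕ}
    {K : Set V} (hK : (0 : V) ∈ K) (h : HasRoundSubquotient n K) :
    ∃ (W : Submodule ℝ V) (U : Submodule ℝ (V ⧸ W)), Module.finrank ℝ U = n ∧
      ∃ E₀ : Set ↥U, IsEllipsoid E₀ ∧ E₀ ⊆ ((↑) ⁻¹' (W.mkQ '' K) : Set ↥U) ∧
        ((↑) ⁻¹' (W.mkQ '' K) : Set ↥U) ⊆ (256 : ℝ) • E₀ := by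
  obtain ⟨Γ, h1, h2⟩ := h
  have hz0 : ∀ z, ((0 : V), z) ∈ Γ → z = 0 := by
    intro z hz
    by_contra hne
    have h3 := h2 0 hK ((257 / ‖z‖) • z) (by simpa using Γ.smul_mem (257 / ‖z‖) hz)
    rw [norm_smul, Real.norm_of_nonneg (by positivity),
      div_mul_cancel₀ _ (norm_ne_zero_iff.2 hne)] at h3
    norm_num at h3
  let W : Submodule ℝ V := Γ.comap (LinearMap.inl ℝ V (EuclideanSpace ℝ (Fin n)))
  have hW : ∀ x, x ∈ W ↔ (x, 0) ∈ Γ := fun x => Iff.rfl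
  let p : Γ →ₗ[ℝ] EuclideanSpace ℝ (Fin n) := LinearMap.snd ℝ V _ ∘ₗ Γ.subtype
  have hp : Function.Surjective p := by
    intro z
    rcases eq_or_ne z 0 with rfl | hz
    · exact ⟨0, rfl⟩
    have hz' : ‖z‖ ≠ 0 := norm_ne_zero_iff.2 hz
    obtain ⟨x, -, hx⟩ := h1 (‖z‖⁻¹ • z) (by rw [norm_smul, norm_inv, norm_norm, inv_mul_cancel₀ hz'])
    refine ⟨⟨_, Γ.smul_mem ‖z‖ hx⟩, ?_⟩
    simp [p, smul_smul, mul_inv_cancel₀ hz']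
  obtain ⟨σ, hσ⟩ := p.exists_rightInverse_of_surjective (LinearMap.range_eq_top.2 hp)
  have hσ' : ∀ z, ((σ z : V × EuclideanSpace ℝ (Fin n)).1, z) ∈ Γ := fun z => by
    have h3 : (σ z : V × EuclideanSpace ℝ (Fin n)).2 = z := LinearMap.congr_fun hσ z
    convert (σ z).2 using 1
    exact Prod.ext rfl h3.symm
  let L : EuclideanSpace ℝ (Fin n) →ₗ[ℝ] V ⧸ W := W.mkQ ∘ₗ LinearMap.fst ℝ V _ ∘ₗ Γ.subtype ∘ₗ σ
  have hL : ∀ x z, L z = W.mkQ x ↔ (x, z) ∈ Γ := by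
    intro x z
    have h3 : L z = W.mkQ (σ z : V × EuclideanSpace ℝ (Fin n)).1 := rfl
    rw [h3, Submodule.mkQ_apply, Submodule.mkQ_apply, Submodule.Quotient.eq, hW]
    constructor
    · intro h
      simpa using Γ.sub_mem (hσ' z) h
    · intro h
      simpa using Γ.sub_mem (hσ' z) h
  have hLinj : Function.Injective L := by
    rw [← LinearMap.ker_eq_bot, LinearMap.ker_eq_bot']
    intro z hz
    exact hz0 z ((hL 0 z).1 (by simpa using hz))
  have hLbij : Function.Bijective L.rangeRestrict :=
    ⟨fun a b hab => hLinj (congrArg Subtype.val hab), L.surjective_rangeRestrict⟩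
  refine ⟨W, LinearMap.range L, ?_, L.rangeRestrict '' Metric.closedBall 0 1,
    ⟨n, L.rangeRestrict, hLbij, rfl⟩, ?_, ?_⟩
  · rw [LinearMap.finrank_range_of_inj hLinj, finrank_euclideanSpace_fin]
  · rintro _ ⟨z, hz, rfl⟩
    obtain ⟨x, hx, hxz⟩ := h1 z (by simpa using hz)
    exact ⟨x, hx, ((hL x z).2 hxz).symm⟩
  · rintro ⟨_, z, rfl⟩ ⟨x, hx, hxz⟩
    have h3 := h2 x hx z ((hL x z).1 hxz.symm)
    refine Set.mem_smul_set.2 ⟨L.rangeRestrict ((256 : ℝ)⁻¹ • z), ⟨_, ?_, rfl⟩, ?_⟩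
    · rw [mem_closedBall_zero_iff, norm_smul]
      norm_num
      linarith
    · rw [map_smul, smul_smul]
      norm_num
      rfl

/-- The polar body of a symmetric set. -/
def polarBody {V : Type*} [NormedAddCommGroup V] [InnerProductSpace ℝ V] (K : Set V) : Set V :=
  {y | ∀ x ∈ K, inner ℝ x y ≤ 1}

theorem HasRoundSubquotient.of_polarBody {V : Type*} [NormedAddCommGroup V] [InnerProductSpace ℝ V]
    [FiniteDimensional ℝ V] {n : ℕ} {K : Set V} (hK : IsCompact K) (hconv : Convex ℝ K)
    (h0 : (0 : V) ∈ K) (h : HasRoundSubquotient n (polarBody K)) : HasRoundSubquotient n K := by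
  obtain ⟨Γ, h1, h2⟩ := h
  let H := WithLp 2 (V × EuclideanSpace ℝ (Fin n))
  let e : H ≃ₗ[ℝ] V × EuclideanSpace ℝ (Fin n) := WithLp.linearEquiv 2 ℝ _
  let Γ' : Submodule ℝ H := Γ.comap e.toLinearMap
  let N : (V × EuclideanSpace ℝ (Fin n)) →ₗ[ℝ] H :=
    e.symm.toLinearMap ∘ₗ LinearMap.prodMap LinearMap.id ((-(256 : ℝ)⁻¹) • LinearMap.id)
  have hin : ∀ x z y w, inner ℝ (WithLp.toLp 2 (y, w) : H) (N (x, z)) =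
      inner ℝ y x - (256 : ℝ)⁻¹ * inner ℝ w z := by
    intro x z y w
    rw [WithLp.prod_inner_apply]
    have h3 : ∀ q, (WithLp.fst (e.symm q), WithLp.snd (e.symm q)) = q := fun q => rfl
    have h4 := congrArg Prod.fst (h3 (x, (-(256 : ℝ)⁻¹) • z))
    have h5 := congrArg Prod.snd (h3 (x, (-(256 : ℝ)⁻¹) • z))
    dsimp only at h4 h5
    change inner ℝ y (WithLp.fst (e.symm (x, (-(256 : ℝ)⁻¹) • z))) +
      inner ℝ w (WithLp.snd (e.symm (x, (-(256 : ℝ)⁻¹) • z))) = _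
    rw [h4, h5, inner_smul_right]
    ring
  have hmem : ∀ x z, (x, z) ∈ Γ'ᗮ.comap N ↔
      ∀ y w, (y, w) ∈ Γ → inner ℝ y x = 256⁻¹ * inner ℝ w z := by
    intro x z
    rw [Submodule.mem_comap, Submodule.mem_orthogonal]
    constructor
    · intro h y w hyw
      have := h (WithLp.toLp 2 (y, w)) hyw
      rw [hin] at this
      linarith
    · intro h u hu
      have := h u.fst u.snd hu
      have h3 := hin x z u.fst u.snd
      rw [this, sub_self] at h3
      exact h3
  refine ⟨Γ'ᗮ.comap N, fun z hz => ?_, fun x hx z hxz => ?_⟩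
  · by_contra hcon
    push Not at hcon
    have hC : IsCompact ((fun x => N (x, z)) '' K) := by
      refine hK.image ?_
      exact N.continuous_of_finiteDimensional.comp (by fun_prop)
    have hconv' : Convex ℝ ((fun x => N (x, z)) '' K) := by
      have : (fun x => N (x, z)) '' K =
          (fun u => N (0, z) + u) '' ((N ∘ₗ LinearMap.inl ℝ V _) '' K) := by
        rw [Set.image_image]
        refine Set.image_congr fun x _ => ?_
        simp [← map_add]
      rw [this]
      exact (hconv.linear_image _).translate _
    obtain ⟨f, u, v, hu, huv, hv⟩ := geometric_hahn_banach_compact_closed hconv' hC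
      Γ'ᗮ.convex Γ'ᗮ.closed_of_finiteDimensional (by
        rw [Set.disjoint_left]
        rintro _ ⟨x, hx, rfl⟩ hx'
        exact hcon x hx hx')
    have hf0 : ∀ b ∈ Γ'ᗮ, f b = 0 := by
      intro b hb
      by_contra hne
      have := hv (((v - 1) / f b) • b) (Γ'ᗮ.smul_mem _ hb)
      rw [map_smul, smul_eq_mul, div_mul_cancel₀ _ hne] at this
      linarith
    have hv0 : v < 0 := by simpa using hv 0 (Γ'ᗮ.zero_mem)
    let g : H := (InnerProductSpace.toDual ℝ H).symm f
    have hg : ∀ b, inner ℝ g b = f b := fun b => by simp [g]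
    have hgΓ : g ∈ Γ' := by
      rw [← Submodule.orthogonal_orthogonal Γ', Submodule.mem_orthogonal']
      intro b hb
      rw [hg, hf0 b hb]
    have hgK : ∀ x ∈ K, inner ℝ g.fst x - 256⁻¹ * inner ℝ g.snd z < u := by
      intro x hx
      have h3 := hu _ ⟨x, hx, rfl⟩
      rw [← hg] at h3
      have h4 := hin x z g.fst g.snd
      exact h4 ▸ h3
    have hu0 : u < 0 := huv.trans hv0
    set t := 256⁻¹ * inner ℝ g.snd z with ht
    have hspos : 0 < t + u := by
      have := hgK 0 h0
      rw [inner_zero_right] at this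
      linarith
    have h5 := h2 ((t + u)⁻¹ • g.fst) (fun x hx => by
      rw [inner_smul_right, real_inner_comm, inv_mul_le_iff₀ hspos]
      have := hgK x hx
      linarith) ((t + u)⁻¹ • g.snd) (Γ.smul_mem (t + u)⁻¹ hgΓ)
    rw [norm_smul, norm_inv, Real.norm_of_nonneg hspos.le, inv_mul_le_iff₀ hspos] at h5
    have h6 : inner ℝ g.snd z ≤ ‖g.snd‖ * ‖z‖ := real_inner_le_norm _ _
    have h7 : ‖g.snd‖ * ‖z‖ ≤ ‖g.snd‖ := mul_le_of_le_one_right (norm_nonneg _) hz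
    linarith
  · rw [hmem] at hxz
    rcases eq_or_ne z 0 with rfl | hz
    · simp
    have hz' : ‖z‖ ≠ 0 := norm_ne_zero_iff.2 hz
    obtain ⟨y, hy, hyw⟩ := h1 (‖z‖⁻¹ • z)
      (by rw [norm_smul, norm_inv, norm_norm, inv_mul_cancel₀ hz'])
    have h3 := hxz _ _ hyw
    have h4 := hy x hx
    rw [real_inner_comm, h3, real_inner_smul_left, real_inner_self_eq_norm_sq, sq,
      inv_mul_cancel_left₀ hz'] at h4
    linarith

theorem lintegral_fun_norm_eq {E : Type*} [NormedAddCommGroup E] [NormedSpace ℝ E]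
    [MeasurableSpace E] [BorelSpace E] [Nontrivial E] [FiniteDimensional ℝ E] (μ : Measure E)
    [μ.IsAddHaarMeasure] {f : ℝ → ENNReal} (hf : Measurable f) :
    ∫⁻ x, f ‖x‖ ∂μ = Module.finrank ℝ E * μ (Metric.ball 0 1) *
      ∫⁻ t in Set.Ioi (0 : ℝ), ENNReal.ofReal (t ^ (Module.finrank ℝ E - 1)) * f t := by
  calc ∫⁻ x, f ‖x‖ ∂μ = ∫⁻ x : ({(0)}ᶜ : Set E), f ‖x.1‖ ∂(μ.comap (↑)) := by
        rw [lintegral_subtype_comap (measurableSet_singleton _).compl fun x => f ‖x‖,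
          restrict_compl_singleton]
    _ = ∫⁻ x, f x.2 ∂μ.toSphere.prod (.volumeIoiPow (Module.finrank ℝ E - 1)) := by
        rw [← μ.measurePreserving_homeomorphUnitSphereProd.lintegral_comp_emb
          (Homeomorph.measurableEmbedding _)]
        simp only [homeomorphUnitSphereProd_apply_snd_coe]
    _ = μ.toSphere Set.univ *
        ∫⁻ x : Set.Ioi (0 : ℝ), f x ∂.volumeIoiPow (Module.finrank ℝ E - 1) := by
        rw [lintegral_prod _ (by fun_prop)]
        simp [mul_comm]
    _ = _ := by
        rw [Measure.volumeIoiPow, lintegral_withDensity_eq_lintegral_mul _ (by fun_prop)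
          (by fun_prop), μ.toSphere_apply_univ]
        congr 1
        exact lintegral_subtype_comap measurableSet_Ioi
          fun t => ENNReal.ofReal (t ^ (Module.finrank ℝ E - 1)) * f t

instance {E : Type*} [NormedAddCommGroup E] [InnerProductSpace ℝ E] [FiniteDimensional ℝ E] :
    CompactSpace (unitary (E →L[ℝ] E)) := by
  have : ProperSpace (E →L[ℝ] E) := FiniteDimensional.proper_real _
  refine isCompact_iff_compactSpace.1 ?_
  refine (isCompact_closedBall (0 : E →L[ℝ] E) 1).of_isClosed_subset isClosed_unitary ?_
  intro g hg
  rw [mem_closedBall_zero_iff]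
  exact g.opNorm_le_bound zero_le_one fun x => by
    rw [one_mul, g.norm_map_of_mem_unitary hg]

theorem exists_unitary_apply_eq {E : Type*} [NormedAddCommGroup E] [InnerProductSpace ℝ E]
    [FiniteDimensional ℝ E] {x y : E} (h : ‖x‖ = ‖y‖) :
    ∃ g : unitary (E →L[ℝ] E), (g : E →L[ℝ] E) x = y := by
  refine ⟨Unitary.linearIsometryEquiv.symm (Submodule.reflection (ℝ ∙ (x - y))ᗮ), ?_⟩
  simpa using Submodule.reflection_sub h

theorem exists_linearIsometry {m N : ℕ} (h : m ≤ N) :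
    Nonempty (EuclideanSpace ℝ (Fin m) →ₗᵢ[ℝ] EuclideanSpace ℝ (Fin N)) := by
  let b := EuclideanSpace.basisFun (Fin m) ℝ
  let c := EuclideanSpace.basisFun (Fin N) ℝ
  refine ⟨(b.toBasis.constr ℝ (c ∘ Fin.castLE h)).isometryOfOrthonormal (v := b.toBasis)
    (by simp) ?_⟩
  have : ⇑(b.toBasis.constr ℝ (c ∘ Fin.castLE h)) ∘ b.toBasis = c ∘ Fin.castLE h := by
    ext1 i
    simp
  rw [this]
  exact c.orthonormal.comp _ (Fin.castLE_injective h)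

theorem exists_linearIsometry_lintegral_le {E F : Type*} [NormedAddCommGroup E]
    [InnerProductSpace ℝ E] [FiniteDimensional ℝ E] [MeasurableSpace E] [BorelSpace E]
    [NormedAddCommGroup F] [InnerProductSpace ℝ F] [FiniteDimensional ℝ F] [MeasurableSpace F]
    [BorelSpace F] {m : ℕ} (hm : 1 ≤ m) (hF : Module.finrank ℝ F = m)
    (hE : Module.finrank ℝ E = 2 * m) (i₀ : F →ₗᵢ[ℝ] E) {K : Set E} (hK : MeasurableSet K) :
    ∃ i : F →ₗᵢ[ℝ] E,
      2 * volume (Metric.ball (0 : E) 1) * ∫⁻ x in i ⁻¹' K, ENNReal.ofReal (‖x‖ ^ m) ≤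
      volume (Metric.ball (0 : F) 1) * volume K := by
  have : ProperSpace (E →L[ℝ] E) := FiniteDimensional.proper_real _
  let : MeasurableSpace (unitary (E →L[ℝ] E)) := borel _
  have : BorelSpace (unitary (E →L[ℝ] E)) := ⟨rfl⟩
  let μ : Measure (unitary (E →L[ℝ] E)) := Measure.haarMeasure ⊤
  have : IsProbabilityMeasure μ := ⟨by
    simpa using Measure.haarMeasure_self (G := unitary (E →L[ℝ] E)) (K₀ := ⊤)⟩
  have hcont : Continuous fun p : unitary (E →L[ℝ] E) × E => (star (p.1 : E →L[ℝ] E)) p.2 := by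
    have h1 : Continuous fun p : unitary (E →L[ℝ] E) × E => star (p.1 : E →L[ℝ] E) := by fun_prop
    exact h1.clm_apply continuous_snd
  obtain ⟨φ, hφK, hφ⟩ : ∃ φ : unitary (E →L[ℝ] E) → E → ENNReal,
      (∀ g x, φ g x = K.indicator 1 ((star (g : E →L[ℝ] E)) x)) ∧
        Measurable fun p : unitary (E →L[ℝ] E) × E => φ p.1 p.2 :=
    ⟨_, fun _ _ => rfl, (measurable_one.indicator hK).comp hcont.measurable⟩
  let Φ : E → ENNReal := fun x => ∫⁻ g, φ g x ∂μ
  have hΦ : Measurable Φ := (hφ.comp measurable_swap).lintegral_prod_right'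
  have hΦinv : ∀ x y : E, ‖x‖ = ‖y‖ → Φ x = Φ y := by
    intro x y hxy
    obtain ⟨h, hh⟩ := exists_unitary_apply_eq hxy
    calc Φ x = ∫⁻ g, φ (h * g) y ∂μ := by
          refine lintegral_congr fun g => ?_
          have h1 : (star ((h * g : unitary (E →L[ℝ] E)) : E →L[ℝ] E)) y = (star (g : E →L[ℝ] E)) x := by
            rw [← hh]
            have h2 : star ((h * g : unitary (E →L[ℝ] E)) : E →L[ℝ] E) * (h : E →L[ℝ] E) =
                star (g : E →L[ℝ] E) := by
              simp [mul_assoc]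
            exact congrArg (fun T : E →L[ℝ] E => T x) h2
          simp only [hφK, h1]
      _ = Φ y := lintegral_mul_left_eq_self (fun g => φ g y) h
  have : Nontrivial E := Module.nontrivial_of_finrank_pos (R := ℝ) (by omega)
  have : Nontrivial F := Module.nontrivial_of_finrank_pos (R := ℝ) (by omega)
  obtain ⟨e, he⟩ := exists_norm_eq E zero_le_one
  let f : ℝ → ENNReal := fun t => Φ (t • e)
  have hf : Measurable f := hΦ.comp (by fun_prop)
  have hΦf : ∀ x, Φ x = f ‖x‖ := fun x => hΦinv _ _ (by simp [norm_smul, he])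
  let V : ENNReal := ∫⁻ t in Set.Ioi (0 : ℝ), ENNReal.ofReal (t ^ (2 * m - 1)) * f t
  have hvol : volume K = (2 * m : ℕ) * volume (Metric.ball (0 : E) 1) * V := by
    have h1 : ∀ g : unitary (E →L[ℝ] E), ∫⁻ x, φ g x = volume K := by
      intro g
      have h2 := (Unitary.linearIsometryEquiv (star g)).measurePreserving.lintegral_comp
        (measurable_one.indicator hK)
      rw [lintegral_indicator_one hK] at h2
      rw [← h2]
      exact lintegral_congr fun x => hφK g x
    calc volume K = ∫⁻ g, (∫⁻ x, φ g x) ∂μ := by simp [h1]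
      _ = ∫⁻ x, Φ x := lintegral_lintegral_swap hφ.aemeasurable
      _ = ∫⁻ x : E, f ‖x‖ := by simp only [hΦf]
      _ = _ := by rw [lintegral_fun_norm_eq _ hf, hE]
  have hφ' : Measurable fun p : unitary (E →L[ℝ] E) × F =>
      ENNReal.ofReal (‖p.2‖ ^ m) * φ p.1 (i₀ p.2) := by
    have h1 : Measurable fun p : unitary (E →L[ℝ] E) × F => (p.1, i₀ p.2) :=
      measurable_fst.prodMk (i₀.continuous.measurable.comp measurable_snd)
    have h2 : Measurable fun p : unitary (E →L[ℝ] E) × F => ENNReal.ofReal (‖p.2‖ ^ m) := by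
      fun_prop
    exact h2.mul (hφ.comp h1)
  have hint : ∫⁻ g, (∫⁻ x : F, ENNReal.ofReal (‖x‖ ^ m) * φ g (i₀ x)) ∂μ =
      m * volume (Metric.ball (0 : F) 1) * V := by
    rw [lintegral_lintegral_swap hφ'.aemeasurable]
    calc _ = ∫⁻ x : F, ENNReal.ofReal (‖x‖ ^ m) * f ‖x‖ := by
          refine lintegral_congr fun x => ?_
          rw [lintegral_const_mul' _ _ ENNReal.ofReal_ne_top]
          congr 1
          exact (hΦf _).trans (by rw [i₀.norm_map])
      _ = _ := by
          rw [lintegral_fun_norm_eq _ (f := fun t => ENNReal.ofReal (t ^ m) * f t) (by fun_prop)]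
          simp only [hF, V]
          congr 1
          refine setLIntegral_congr_fun measurableSet_Ioi fun t ht => ?_
          have ht' : 0 ≤ t := le_of_lt ht
          rw [← mul_assoc, ← ENNReal.ofReal_mul (by positivity), ← pow_add]
          congr 3
          omega
  obtain ⟨g, hg⟩ := exists_le_lintegral (μ := μ) (f := fun g =>
    ∫⁻ x : F, ENNReal.ofReal (‖x‖ ^ m) * φ g (i₀ x)) hφ'.lintegral_prod_right'.aemeasurable
  rw [hint] at hg
  refine ⟨(Unitary.linearIsometryEquiv (star g)).toLinearIsometry.comp i₀, ?_⟩
  set i := (Unitary.linearIsometryEquiv (star g)).toLinearIsometry.comp i₀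
  have hi : MeasurableSet (i ⁻¹' K) := i.continuous.measurable hK
  have h1 : ∫⁻ x in i ⁻¹' K, ENNReal.ofReal (‖x‖ ^ m) =
      ∫⁻ x : F, ENNReal.ofReal (‖x‖ ^ m) * φ g (i₀ x) := by
    rw [← lintegral_indicator hi]
    refine lintegral_congr fun x => ?_
    by_cases hx : i x ∈ K
    · have hx' : φ g (i₀ x) = 1 := (hφK _ _).trans <| Set.indicator_of_mem (s := K) hx 1
      rw [hx', mul_one, Set.indicator_of_mem (s := i ⁻¹' K) hx]
    · have hx' : φ g (i₀ x) = 0 := (hφK _ _).trans <| Set.indicator_of_notMem (s := K) hx 1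
      rw [hx', mul_zero, Set.indicator_of_notMem (s := i ⁻¹' K) hx]
  rw [h1, hvol]
  refine (mul_le_mul_right hg _).trans (le_of_eq ?_)
  push_cast
  ring

theorem norm_pow_mul_measure_le {E : Type*} [NormedAddCommGroup E] [InnerProductSpace ℝ E]
    [FiniteDimensional ℝ E] [MeasurableSpace E] [BorelSpace E] {m : ℕ}
    (hE : Module.finrank ℝ E = m) (μ : Measure E) [μ.IsAddHaarMeasure] {K : Set E}
    (hconv : Convex ℝ K) (hsymm : ∀ x ∈ K, -x ∈ K) {x₀ : E} (hx₀ : x₀ ∈ K) :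
    ENNReal.ofReal (‖x₀‖ ^ m) * μ K ≤
      2 * 4 ^ m * ∫⁻ x in K, ENNReal.ofReal (‖x‖ ^ m) ∂μ := by
  let H : Set E := {y ∈ K | 0 ≤ inner ℝ y x₀}
  let S : Set E := (1 / 2 : ℝ) • (x₀ +ᵥ H)
  have hKH : μ K ≤ 2 * μ H := by
    calc μ K ≤ μ (H ∪ -H) := by
          refine measure_mono fun y hy => ?_
          rcases le_total 0 (inner ℝ y x₀) with h | h
          · exact Or.inl ⟨hy, h⟩
          · exact Or.inr ⟨hsymm y hy, by simpa using h⟩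
      _ ≤ μ H + μ (-H) := measure_union_le _ _
      _ = 2 * μ H := by rw [Measure.measure_neg, two_mul]
  have hS : 2 ^ m * μ S = μ H := by
    rw [Measure.addHaar_smul, hE, measure_vadd, ← mul_assoc, abs_of_nonneg (by positivity),
      ENNReal.ofReal_pow (by positivity), ← mul_pow]
    have : (2 : ENNReal) * ENNReal.ofReal (1 / 2) = 1 := by
      rw [← ENNReal.ofReal_ofNat 2, ← ENNReal.ofReal_mul (by positivity)]
      norm_num
    rw [this, one_pow, one_mul]
  have hSK : S ⊆ K := by
    rintro _ ⟨_, ⟨y, hy, rfl⟩, rfl⟩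
    simpa [smul_add] using
      hconv hx₀ hy.1 (by norm_num : (0 : ℝ) ≤ 1 / 2) (by norm_num : (0 : ℝ) ≤ 1 / 2) (by norm_num)
  have hSn : ∀ s ∈ S, ‖x₀‖ ≤ 2 * ‖s‖ := by
    rintro _ ⟨_, ⟨y, hy, rfl⟩, rfl⟩
    have h1 : ‖x₀ + y‖ ^ 2 = ‖x₀‖ ^ 2 + 2 * inner ℝ x₀ y + ‖y‖ ^ 2 := norm_add_sq_real x₀ y
    have h2 : 0 ≤ inner ℝ x₀ y := by rw [real_inner_comm]; exact hy.2
    have h3 : ‖x₀‖ ≤ ‖x₀ + y‖ :=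
      (abs_le_of_sq_le_sq' (by nlinarith [sq_nonneg ‖y‖]) (norm_nonneg _)).2
    change _ ≤ 2 * ‖(1 / 2 : ℝ) • (x₀ + y)‖
    rw [norm_smul, Real.norm_of_nonneg (by positivity)]
    linarith
  have hint : ENNReal.ofReal (‖x₀‖ ^ m) * μ S ≤
      2 ^ m * ∫⁻ x in K, ENNReal.ofReal (‖x‖ ^ m) ∂μ := by
    calc ENNReal.ofReal (‖x₀‖ ^ m) * μ S = ∫⁻ x in S, ENNReal.ofReal (‖x₀‖ ^ m) ∂μ := by
          rw [setLIntegral_const]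
      _ ≤ ∫⁻ x in S, 2 ^ m * ENNReal.ofReal (‖x‖ ^ m) ∂μ := by
          refine setLIntegral_mono (by fun_prop) fun s hs => ?_
          rw [← ENNReal.ofReal_ofNat 2, ← ENNReal.ofReal_pow (by positivity),
            ← ENNReal.ofReal_mul (by positivity), ← mul_pow]
          exact ENNReal.ofReal_le_ofReal (pow_le_pow_left₀ (norm_nonneg _) (hSn s hs) m)
      _ ≤ ∫⁻ x in K, 2 ^ m * ENNReal.ofReal (‖x‖ ^ m) ∂μ := lintegral_mono_set hSK
      _ = _ := by rw [lintegral_const_mul _ (by fun_prop)]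
  calc ENNReal.ofReal (‖x₀‖ ^ m) * μ K ≤ ENNReal.ofReal (‖x₀‖ ^ m) * (2 * μ H) := by gcongr
    _ = 2 * 2 ^ m * (ENNReal.ofReal (‖x₀‖ ^ m) * μ S) := by rw [← hS]; ring
    _ ≤ 2 * 2 ^ m * (2 ^ m * ∫⁻ x in K, ENNReal.ofReal (‖x‖ ^ m) ∂μ) := by gcongr
    _ = _ := by
        rw [show (4 : ENNReal) = 2 * 2 by norm_num, mul_pow]
        ring

theorem exists_linearIsometry_norm_pow_mul_volume_le {m N : ℕ} (hm : 1 ≤ m) (hN : N = 2 * m)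
    {K : Set (EuclideanSpace ℝ (Fin N))} (hcomp : IsCompact K) (hconv : Convex ℝ K)
    (hsymm : ∀ x ∈ K, -x ∈ K) {r : ℝ}
    (hvol : volume K ≤ ENNReal.ofReal (r ^ N) *
      volume (Metric.closedBall (0 : EuclideanSpace ℝ (Fin N)) 1)) :
    ∃ i : EuclideanSpace ℝ (Fin m) →ₗᵢ[ℝ] EuclideanSpace ℝ (Fin N), ∀ x ∈ i ⁻¹' K,
      ENNReal.ofReal (‖x‖ ^ m) * volume (i ⁻¹' K) ≤ ENNReal.ofReal ((4 * r ^ 2) ^ m) *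
        volume (Metric.closedBall (0 : EuclideanSpace ℝ (Fin m)) 1) := by
  obtain ⟨i₀⟩ := exists_linearIsometry (m := m) (N := N) (by omega)
  obtain ⟨i, hi⟩ := exists_linearIsometry_lintegral_le hm finrank_euclideanSpace_fin
    (by rw [finrank_euclideanSpace_fin, hN]) i₀ hcomp.measurableSet
  refine ⟨i, fun x hx => ?_⟩
  have hb : volume (Metric.ball (0 : EuclideanSpace ℝ (Fin N)) 1) ≠ 0 :=
    (Metric.measure_ball_pos _ _ one_pos).ne'
  have hb' : volume (Metric.ball (0 : EuclideanSpace ℝ (Fin N)) 1) ≠ ⊤ := measure_ball_lt_top.ne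
  have : Nontrivial (EuclideanSpace ℝ (Fin N)) :=
    Module.nontrivial_of_finrank_pos (R := ℝ) (by rw [finrank_euclideanSpace_fin]; omega)
  have : Nontrivial (EuclideanSpace ℝ (Fin m)) :=
    Module.nontrivial_of_finrank_pos (R := ℝ) (by rw [finrank_euclideanSpace_fin]; omega)
  rw [Measure.addHaar_closedBall_eq_addHaar_ball] at hvol ⊢
  have h1 : ENNReal.ofReal (‖x‖ ^ m) * volume (i ⁻¹' K) ≤
      2 * 4 ^ m * ∫⁻ x in i ⁻¹' K, ENNReal.ofReal (‖x‖ ^ m) :=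
    norm_pow_mul_measure_le finrank_euclideanSpace_fin volume
    (hconv.is_linear_preimage i.toLinearMap.isLinear) (fun y hy => by
      simpa using hsymm _ hy) hx
  have h2 : 2 * ∫⁻ x in i ⁻¹' K, ENNReal.ofReal (‖x‖ ^ m) ≤ ENNReal.ofReal (r ^ N) *
      volume (Metric.ball (0 : EuclideanSpace ℝ (Fin m)) 1) := by
    rw [← ENNReal.mul_le_mul_iff_right hb hb']
    calc _ = 2 * volume (Metric.ball (0 : EuclideanSpace ℝ (Fin N)) 1) *
          ∫⁻ x in i ⁻¹' K, ENNReal.ofReal (‖x‖ ^ m) := by ring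
      _ ≤ _ := hi
      _ ≤ volume (Metric.ball (0 : EuclideanSpace ℝ (Fin m)) 1) * (ENNReal.ofReal (r ^ N) *
          volume (Metric.ball (0 : EuclideanSpace ℝ (Fin N)) 1)) := by gcongr
      _ = _ := by ring
  calc _ ≤ _ := h1
    _ = 4 ^ m * (2 * ∫⁻ x in i ⁻¹' K, ENNReal.ofReal (‖x‖ ^ m)) := by ring
    _ ≤ 4 ^ m * (ENNReal.ofReal (r ^ N) *
      volume (Metric.ball (0 : EuclideanSpace ℝ (Fin m)) 1)) := by gcongr
    _ = _ := by
      rw [← mul_assoc, ← ENNReal.ofReal_ofNat 4, ← ENNReal.ofReal_pow (by positivity),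
        ← ENNReal.ofReal_mul (by positivity), hN, pow_mul, ← mul_pow]

theorem HasRoundSubquotient.of_closedBall_subset {m n : ℕ} (hmn : m = n)
    {K : Set (EuclideanSpace ℝ (Fin m))} (hK : Metric.closedBall 0 1 ⊆ K)
    (hK' : K ⊆ Metric.closedBall 0 256) : HasRoundSubquotient n K := by
  subst hmn
  refine ⟨LinearMap.graph LinearMap.id, fun z hz => ⟨z, hK (by simpa using hz), by simp⟩, ?_⟩
  intro x hx z hxz
  obtain rfl : z = x := by simpa using hxz
  simpa using hK' hx

theorem polarBody_subset_closedBall {V : Type*} [NormedAddCommGroup V] [InnerProductSpace ℝ V]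
    {K : Set V} {a : ℝ} (ha : 0 < a) (hK : Metric.closedBall 0 a ⊆ K) :
    polarBody K ⊆ Metric.closedBall 0 a⁻¹ := by
  intro y hy
  rw [mem_closedBall_zero_iff]
  rcases eq_or_ne y 0 with rfl | h0
  · simpa using ha.le
  have hy0 : 0 < ‖y‖ := norm_pos_iff.2 h0
  have h1 := hy ((a / ‖y‖) • y) (hK (by
    simp [norm_smul, abs_of_pos ha, hy0.ne']))
  rw [real_inner_smul_left, real_inner_self_eq_norm_sq] at h1
  have h2 : a / ‖y‖ * ‖y‖ ^ 2 = a * ‖y‖ := by field_simp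
  rw [h2] at h1
  rwa [le_inv_comm₀ hy0 ha, ← one_div, le_div_iff₀ hy0]

theorem closedBall_subset_polarBody {V : Type*} [NormedAddCommGroup V] [InnerProductSpace ℝ V]
    {K : Set V} (hK : K ⊆ Metric.closedBall 0 1) :
    Metric.closedBall 0 1 ⊆ polarBody K := by
  intro y hy x hx
  have h1 := mem_closedBall_zero_iff.1 (hK hx)
  have h2 := mem_closedBall_zero_iff.1 hy
  exact (real_inner_le_norm x y).trans (mul_le_one₀ h1 (norm_nonneg _) h2)

theorem isClosed_polarBody {V : Type*} [NormedAddCommGroup V] [InnerProductSpace ℝ V]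
    (K : Set V) : IsClosed (polarBody K) := by
  simp only [polarBody, Set.ofPred_forall]
  exact isClosed_biInter fun x _ => isClosed_le (by fun_prop) continuous_const

theorem convex_polarBody {V : Type*} [NormedAddCommGroup V] [InnerProductSpace ℝ V]
    (K : Set V) : Convex ℝ (polarBody K) := by
  intro y hy z hz a b ha hb hab x hx
  rw [inner_add_right, real_inner_smul_right, real_inner_smul_right]
  nlinarith [hy x hx, hz x hx]

theorem volume_polarBody_mul_volume_le {ι : Type*} [Fintype ι] {K : Set (EuclideanSpace ℝ ι)}
    (hK : IsCompact K) (hP : IsCompact (polarBody K)) (hsymm : ∀ x ∈ K, -x ∈ K) :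
    volume (polarBody K) * volume K ≤
      volume (Metric.closedBall (0 : EuclideanSpace ℝ ι) 1) ^ 2 := by
  refine volume_mul_volume_le_of_abs_inner_le_one hP hK hsymm fun y hy x hx => ?_
  rw [real_inner_comm, abs_le]
  have h := hy (-x) (hsymm x hx)
  rw [inner_neg_left] at h
  exact ⟨by linarith, hy x hx⟩

theorem hasRoundSubquotient_of_volume_le {m n : ℕ} (hm : 1 ≤ m) {r s : ℝ} (hs : 0 < s)
    (hrs : s ^ 3 = 4 * r ^ 2) {K : Set (EuclideanSpace ℝ (Fin m))} (hcomp : IsCompact K)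
    (hconv : Convex ℝ K) (hsymm : ∀ x ∈ K, -x ∈ K) (hball : Metric.closedBall 0 1 ⊆ K)
    (hbound : ∀ x ∈ K, ENNReal.ofReal (‖x‖ ^ m) * volume K ≤ ENNReal.ofReal ((4 * r ^ 2) ^ m) *
      volume (Metric.closedBall (0 : EuclideanSpace ℝ (Fin m)) 1))
    (ih : ∀ L : Set (EuclideanSpace ℝ (Fin m)), IsCompact L → Convex ℝ L → (∀ x ∈ L, -x ∈ L) →
      Metric.closedBall 0 1 ⊆ L → volume L ≤ ENNReal.ofReal (s ^ m) *
        volume (Metric.closedBall (0 : EuclideanSpace ℝ (Fin m)) 1) → HasRoundSubquotient n L) :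
    HasRoundSubquotient n K := by
  set b := volume (Metric.closedBall (0 : EuclideanSpace ℝ (Fin m)) 1)
  have hb : b ≠ 0 := (Metric.measure_closedBall_pos _ _ one_pos).ne'
  have hb' : b ≠ ⊤ := measure_closedBall_lt_top.ne
  have hofReal : ∀ {c d : ℝ}, 0 ≤ c → ENNReal.ofReal c * (ENNReal.ofReal d * b) =
      ENNReal.ofReal (c * d) * b := fun hc => by rw [← mul_assoc, ENNReal.ofReal_mul hc]
  rcases le_or_gt (volume K) (ENNReal.ofReal (s ^ m) * b) with h | h
  · exact ih K hcomp hconv hsymm hball h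
  have hnorm : K ⊆ Metric.closedBall 0 (s ^ 2) := by
    intro x hx
    rw [mem_closedBall_zero_iff]
    have h1 : ENNReal.ofReal ((‖x‖ * s) ^ m) * b ≤ ENNReal.ofReal ((4 * r ^ 2) ^ m) * b := by
      rw [mul_pow, ← hofReal (by positivity)]
      exact (mul_le_mul_right h.le _).trans (hbound x hx)
    rw [ENNReal.mul_le_mul_iff_left hb hb', ENNReal.ofReal_le_ofReal_iff (by positivity),
      pow_le_pow_iff_left₀ (by positivity) (by positivity) (by omega), ← hrs, pow_succ] at h1
    exact le_of_mul_le_mul_right h1 hs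
  have hs2 : s ^ 2 ≠ 0 := by positivity
  let f : EuclideanSpace ℝ (Fin m) →ₗ[ℝ] EuclideanSpace ℝ (Fin m) := s ^ 2 • LinearMap.id
  have hf : ⇑f = fun x => s ^ 2 • x := rfl
  let L := f ⁻¹' K
  have hLcomp : IsCompact L := (Homeomorph.smulOfNeZero (s ^ 2) hs2).isCompact_preimage.2 hcomp
  have hLconv : Convex ℝ L := hconv.linear_preimage f
  have hLsymm : ∀ x ∈ L, -x ∈ L := fun x hx => by
    simpa [L] using hsymm _ hx
  have hLball : Metric.closedBall 0 (s ^ 2)⁻¹ ⊆ L := by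
    intro x hx
    refine hball ?_
    rw [mem_closedBall_zero_iff] at hx ⊢
    rw [hf, norm_smul, Real.norm_of_nonneg (by positivity)]
    calc s ^ 2 * ‖x‖ ≤ s ^ 2 * (s ^ 2)⁻¹ := by gcongr
      _ = 1 := mul_inv_cancel₀ hs2
  have hLball' : L ⊆ Metric.closedBall 0 1 := by
    intro x hx
    have h1 := mem_closedBall_zero_iff.1 (hnorm hx)
    rw [hf, norm_smul, Real.norm_of_nonneg (by positivity)] at h1
    rw [mem_closedBall_zero_iff]
    exact (mul_le_iff_le_one_right (by positivity)).1 h1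
  have hPcomp : IsCompact (polarBody L) :=
    (isCompact_closedBall _ _).of_isClosed_subset (isClosed_polarBody L)
      (polarBody_subset_closedBall (by positivity) hLball)
  have hPsymm : ∀ y ∈ polarBody L, -y ∈ polarBody L := by
    intro y hy x hx
    simpa using hy _ (hLsymm x hx)
  have hLvol : ENNReal.ofReal ((s ^ 2) ^ m) * volume L = volume K := by
    have h1 : volume L = ENNReal.ofReal |((s ^ 2) ^ m)⁻¹| * volume K := by
      have h2 := Measure.addHaar_preimage_smul volume hs2 K
      rwa [finrank_euclideanSpace_fin] at h2
    rw [h1, ← mul_assoc, ← ENNReal.ofReal_mul (by positivity), abs_of_nonneg (by positivity),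
      mul_inv_cancel₀ (by positivity), ENNReal.ofReal_one, one_mul]
  have hPvol : volume (polarBody L) ≤ ENNReal.ofReal (s ^ m) * b := by
    have hsm : ENNReal.ofReal (s ^ m) * b ≠ 0 :=
      mul_ne_zero (by simpa using pow_pos hs m) hb
    rw [← ENNReal.mul_le_mul_iff_left hsm (ENNReal.mul_ne_top ENNReal.ofReal_ne_top hb')]
    calc volume (polarBody L) * (ENNReal.ofReal (s ^ m) * b) ≤ volume (polarBody L) * volume K := by
          gcongr
      _ = ENNReal.ofReal ((s ^ 2) ^ m) * (volume (polarBody L) * volume L) := by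
          rw [← hLvol]
          ring
      _ ≤ ENNReal.ofReal ((s ^ 2) ^ m) * b ^ 2 := by
          gcongr
          exact volume_polarBody_mul_volume_le hLcomp hPcomp hLsymm
      _ = _ := by
          rw [pow_right_comm, sq (s ^ m), ENNReal.ofReal_mul (by positivity)]
          ring
  refine .of_preimage f (.of_polarBody hLcomp hLconv ?_ (ih _ hPcomp (convex_polarBody L) hPsymm
    (closedBall_subset_polarBody hLball') hPvol))
  exact hLball (by simp [sq_nonneg])

theorem hasRoundSubquotient_of_closedBall_subset {n : ℕ} (hn : 1 ≤ n) (k : ℕ)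
    (K : Set (EuclideanSpace ℝ (Fin (2 ^ (k + 1) * n)))) (hcomp : IsCompact K)
    (hconv : Convex ℝ K) (hsymm : ∀ x ∈ K, -x ∈ K) (hball : Metric.closedBall 0 1 ⊆ K)
    (hvol : volume K ≤
      ENNReal.ofReal (((2 : ℝ) ^ ((3 / 2 : ℝ) ^ k) * 4) ^ (2 ^ (k + 1) * n)) *
        volume (Metric.closedBall (0 : EuclideanSpace ℝ (Fin (2 ^ (k + 1) * n))) 1)) :
    HasRoundSubquotient n K := by
  induction k with
  | zero =>
    have hm : 1 ≤ 2 ^ 0 * n := by omega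
    obtain ⟨i, hi⟩ := exists_linearIsometry_norm_pow_mul_volume_le (m := 2 ^ 0 * n) hm (by ring)
      hcomp hconv hsymm hvol
    refine .of_preimage i.toLinearMap (.of_closedBall_subset (by ring) (fun x hx => hball ?_)
      fun x hx => ?_)
    · simpa using hx
    have hle : volume (Metric.closedBall (0 : EuclideanSpace ℝ (Fin (2 ^ 0 * n))) 1) ≤
        volume (i ⁻¹' K) := measure_mono fun x hx => hball (by simpa using hx)
    have h1 := (mul_le_mul_right hle _).trans (hi x hx)
    rw [ENNReal.mul_le_mul_iff_left (Metric.measure_closedBall_pos _ _ one_pos).ne'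
      measure_closedBall_lt_top.ne, ENNReal.ofReal_le_ofReal_iff (by positivity),
      pow_le_pow_iff_left₀ (by positivity) (by positivity) (by omega)] at h1
    rw [mem_closedBall_zero_iff]
    norm_num at h1 ⊢
    exact h1
  | succ k ih =>
    have hm : 1 ≤ 2 ^ (k + 1) * n := Nat.mul_pos (by positivity) hn
    obtain ⟨i, hi⟩ := exists_linearIsometry_norm_pow_mul_volume_le (m := 2 ^ (k + 1) * n) hm
      (by ring) hcomp hconv hsymm hvol
    refine .of_preimage i.toLinearMap (hasRoundSubquotient_of_volume_le hm (by positivity) ?_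
      (i.isometry.isClosedEmbedding.isCompact_preimage hcomp) (hconv.linear_preimage i.toLinearMap)
      (fun x hx => by simpa using hsymm _ hx) (fun x hx => hball (by simpa using hx)) hi ih)
    have h1 : ((2 : ℝ) ^ ((3 / 2 : ℝ) ^ k)) ^ 3 = ((2 : ℝ) ^ ((3 / 2 : ℝ) ^ (k + 1))) ^ 2 := by
      rw [← Real.rpow_mul_natCast zero_le_two, ← Real.rpow_mul_natCast zero_le_two]
      congr 1
      push_cast
      ring
    rw [mul_pow, mul_pow, h1]
    ring

/-- If `K` is a symmetric convex body of dimension `2^(k+1)·n` that is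
`(2^((3/2)^k)·4)`-semiround, then `K` has a `256`-round `n`-dimensional subquotient: a slice
`K₀` of a projection of `K`, of dimension `n`, with an ellipsoid `E₀` satisfying
`E₀ ⊆ K₀ ⊆ 256·E₀`. -/
theorem semiround_has_round_subquotient (k n : ℕ) (hn : 1 ≤ n)
    (K : Set (EuclideanSpace ℝ (Fin (2 ^ (k + 1) * n))))
    (hKconv : Convex ℝ K) (hKcomp : IsCompact K) (hKint : (interior K).Nonempty)
    (hKsymm : ∀ x ∈ K, -x ∈ K)
    (hsemi : ∃ E : Set (EuclideanSpace ℝ (Fin (2 ^ (k + 1) * n))), IsEllipsoid E ∧ E ⊆ K ∧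
      (volume K).toReal ≤
        ((2 : ℝ) ^ ((3 / 2 : ℝ) ^ k) * 4) ^ (2 ^ (k + 1) * n) * (volume E).toReal) :
    ∃ (W : Submodule ℝ (EuclideanSpace ℝ (Fin (2 ^ (k + 1) * n))))
      (U : Submodule ℝ (EuclideanSpace ℝ (Fin (2 ^ (k + 1) * n)) ⧸ W)),
      Module.finrank ℝ U = n ∧
      ∃ E₀ : Set ↥U, IsEllipsoid E₀ ∧
        E₀ ⊆ ((↑) ⁻¹' (W.mkQ '' K) : Set ↥U) ∧
        ((↑) ⁻¹' (W.mkQ '' K) : Set ↥U) ⊆ (256 : ℝ) • E₀ := by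
  obtain ⟨_, ⟨m, L, hL, rfl⟩, hEK, hvol⟩ := hsemi
  obtain rfl : m = 2 ^ (k + 1) * n := by
    simpa using (LinearEquiv.ofBijective L hL).finrank_eq
  have hdet : LinearMap.det L ≠ 0 := by
    have := (LinearEquiv.ofBijective L hL).isUnit_det'
    exact this.ne_zero
  have hLc : Continuous L := L.continuous_of_finiteDimensional
  have hball : Metric.closedBall 0 1 ⊆ L ⁻¹' K := Set.image_subset_iff.1 hEK
  have h0 : (0 : EuclideanSpace ℝ (Fin (2 ^ (k + 1) * n))) ∈ K := by
    simpa using hball (Metric.mem_closedBall_self zero_le_one)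
  refine HasRoundSubquotient.exists_quotient h0 (.of_preimage L
    (hasRoundSubquotient_of_closedBall_subset hn k _ ?_ (hKconv.linear_preimage L)
      (fun x hx => by simpa using hKsymm _ hx) hball ?_))
  · exact (LinearEquiv.ofBijective L hL).toContinuousLinearEquiv.toHomeomorph.isCompact_preimage.2
      hKcomp
  rw [Measure.addHaar_image_linearMap, ENNReal.toReal_mul,
    ENNReal.toReal_ofReal (abs_nonneg _)] at hvol
  rw [Measure.addHaar_preimage_linearMap _ hdet]
  have h1 : volume K ≤ ENNReal.ofReal (((2 : ℝ) ^ ((3 / 2 : ℝ) ^ k) * 4) ^ (2 ^ (k + 1) * n)) *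
      (ENNReal.ofReal |LinearMap.det L| *
        volume (Metric.closedBall (0 : EuclideanSpace ℝ (Fin (2 ^ (k + 1) * n))) 1)) := by
    rw [← ENNReal.toReal_le_toReal hKcomp.measure_lt_top.ne
      (ENNReal.mul_ne_top ENNReal.ofReal_ne_top
        (ENNReal.mul_ne_top ENNReal.ofReal_ne_top measure_closedBall_lt_top.ne)),
      ENNReal.toReal_mul, ENNReal.toReal_mul, ENNReal.toReal_ofReal (by positivity),
      ENNReal.toReal_ofReal (abs_nonneg _)]
    exact hvol
  have h2 : ENNReal.ofReal |(LinearMap.det L)⁻¹| * ENNReal.ofReal |LinearMap.det L| = 1 := by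
    rw [← ENNReal.ofReal_mul (abs_nonneg _), ← abs_mul, inv_mul_cancel₀ hdet, abs_one,
      ENNReal.ofReal_one]
  calc _ ≤ _ := mul_le_mul_right h1 _
    _ = _ := by
      rw [mul_left_comm, ← mul_assoc (ENNReal.ofReal |(LinearMap.det L)⁻¹|), h2, one_mul]
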